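/- arXiv:2405.13735 — 3 statements merged into one kernel-verified Lean document; each statement's English description precedes it below -/
import Mathlib

section
/- Let n, m ∈ ℕ and equip ℝⁿ = (Fin n → ℝ) and ℝᵐ = (Fin m → ℝ) with the sup norm. Let X ⊆ ℝⁿ, f, f̂ : ℝⁿ → ℝᵐ → ℝⁿ, and k, k̂ : ℝⁿ → ℝᵐ. Assume: (i) constants 𝓛ₓ, 𝓛ᵤ ≥ 0 with ‖f x u − f x' u'‖ ≤ 𝓛ₓ‖x − x'‖ + 𝓛ᵤ‖u − u'‖ for all x, x' ∈ X and u, u' ∈ ℝᵐ, and constants 𝓛x̂, 𝓛û ≥ 0 with the analogous bound for f̂; (ii) k is 𝓛ₖ-Lipschitz on X and k̂ is 𝓛k̂-Lipschitz on X; (iii) a finite set X_d ⊆ X and ε > 0 such that every x ∈ X has some xᵢ ∈ X_d with ‖x − xᵢ‖ ≤ ε/2; (iv) 𝓔 ≥ 0 with ‖f xᵢ (k xᵢ) − f̂ xᵢ (k̂ xᵢ)‖ ≤ 𝓔 for all xᵢ ∈ X_d. Then for every x ∈ X, ‖f x (k x) − f̂ x (k̂ x)‖ ≤ (𝓛ₓ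 + 𝓛ᵤ·𝓛ₖ + 𝓛x̂ + 𝓛û·𝓛k̂)·(ε/2) + 𝓔. -/
/-- Closed-loop mismatch bound on the whole state set from the mixed
Lipschitz assumptions, controller Lipschitz bounds, a finite (ε/2)-cover, and the
sample mismatch bound. -/
theorem closed_loop_mismatch_bound
    {n m : ℕ}
    (X : Set (Fin n → ℝ))
    (f fhat : (Fin n → ℝ) → (Fin m → ℝ) → (Fin n → ℝ))
    (k khat : (Fin n → ℝ) → (Fin m → ℝ))
    (Lx Lu Lxhat Luhat Lk Lkhat ε E : ℝ)
    (hLx : 0 ≤ Lx) (hLu : 0 ≤ Lu) (hLxhat : 0 ≤ Lxhat) (hLuhat : 0 ≤ Luhat)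
    (hLk : 0 ≤ Lk) (hLkhat : 0 ≤ Lkhat) (hε : 0 < ε) (hE : 0 ≤ E)
    (hf : ∀ x ∈ X, ∀ x' ∈ X, ∀ u u' : Fin m → ℝ,
      ‖f x u - f x' u'‖ ≤ Lx * ‖x - x'‖ + Lu * ‖u - u'‖)
    (hfhat : ∀ x ∈ X, ∀ x' ∈ X, ∀ u u' : Fin m → ℝ,
      ‖fhat x u - fhat x' u'‖ ≤ Lxhat * ‖x - x'‖ + Luhat * ‖u - u'‖)
    (hk : ∀ x ∈ X, ∀ x' ∈ X, ‖k x - k x'‖ ≤ Lk * ‖x - x'‖)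
    (hkhat : ∀ x ∈ X, ∀ x' ∈ X, ‖khat x - khat x'‖ ≤ Lkhat * ‖x - x'‖)
    (Xd : Finset (Fin n → ℝ)) (hXdX : ↑Xd ⊆ X)
    (hcover : ∀ x ∈ X, ∃ xi ∈ Xd, ‖x - xi‖ ≤ ε / 2)
    (hmismatch : ∀ xi ∈ Xd, ‖f xi (k xi) - fhat xi (khat xi)‖ ≤ E) :
    ∀ x ∈ X, ‖f x (k x) - fhat x (khat x)‖ ≤
      (Lx + Lu * Lk + Lxhat + Luhat * Lkhat) * (ε / 2) + E := by
  intro x hx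
  obtain ⟨y, hy, hxy⟩ := hcover x hx
  have hyX : y ∈ X := hXdX (Finset.mem_coe.2 hy)
  have h1 := hf x hx y hyX (k x) (k y)
  have h2 := hfhat y hyX x hx (khat y) (khat x)
  have h3 := mul_le_mul_of_nonneg_left (hk x hx y hyX) hLu
  have h4 := mul_le_mul_of_nonneg_left (hkhat y hyX x hx) hLuhat
  rw [norm_sub_rev y x] at h2 h4
  have h5 := hmismatch y hy
  have hC : 0 ≤ Lx + Lu * Lk + Lxhat + Luhat * Lkhat := by positivity
  have h6 := mul_le_mul_of_nonneg_left hxy hC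
  have h7 : ‖f x (k x) - fhat x (khat x)‖ ≤ ‖f x (k x) - f y (k y)‖
      + ‖f y (k y) - fhat y (khat y)‖ + ‖fhat y (khat y) - fhat x (khat x)‖ := by
    have e : f x (k x) - fhat x (khat x) = (f x (k x) - f y (k y))
      + (f y (k y) - fhat y (khat y)) + (fhat y (khat y) - fhat x (khat x)) := by abel
    rw [e]
    exact norm_add₃_le
  linarith
end

section
/- Let n, m ∈ ℕ and equip ℝⁿ = (Fin n → ℝ) and ℝᵐ = (Fin m → ℝ) with the sup norm. Let X ⊆ ℝⁿ, f, f̂ : ℝⁿ → ℝᵐ → ℝⁿ, k, k̂ : ℝⁿ → ℝᵐ, B : ℝⁿ → ℝ with B 𝓛_B-Lipschitz, and η ≥ 0. Assume: (i) mixed Lipschitz bounds ‖f x u − f x' u'‖ ≤ 𝓛ₓ‖x − x'‖ + 𝓛ᵤ‖u − u'‖ and ‖f̂ x u − f̂ x' u'‖ ≤ 𝓛x̂‖x − x'‖ + 𝓛û‖u − u'‖ for all x, x' ∈ X and u, u' ∈ ℝᵐ; (ii) k is 𝓛ₖ-Lipschitz and k̂ is 𝓛k̂-Lipschitz on X; (iii)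 a finite set X_d ⊆ X and ε > 0 such that every x ∈ X has some xᵢ ∈ X_d with ‖x − xᵢ‖ ≤ ε/2; (iv) 𝓔 ≥ 0 with ‖f xᵢ (k xᵢ) − f̂ xᵢ (k̂ xᵢ)‖ ≤ 𝓔 for all xᵢ ∈ X_d; (v) the source decrement condition B (f x (k x)) − B x ≤ −η for all x ∈ X. Then for every x ∈ X, B (f̂ x (k̂ x)) − B x ≤ 𝓛_B·((𝓛ₓ + 𝓛ᵤ·𝓛ₖ + 𝓛x̂ + 𝓛û·𝓛k̂)·(ε/2) + 𝓔) − η. -/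
/-- The quantitative barrier-decrement bound for the target closed loop:
B(f̂ x (k̂ x)) − B x ≤ 𝓛_B·((𝓛ₓ + 𝓛ᵤ𝓛ₖ + 𝓛x̂ + 𝓛û𝓛k̂)·(ε/2) + 𝓔) − η on X. -/
theorem target_decrement_bound
    {n m : ℕ}
    (X : Set (Fin n → ℝ))
    (f fhat : (Fin n → ℝ) → (Fin m → ℝ) → (Fin n → ℝ))
    (k khat : (Fin n → ℝ) → (Fin m → ℝ))
    (B : (Fin n → ℝ) → ℝ)
    (Lx Lu Lxhat Luhat Lk Lkhat LB η ε E : ℝ)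
    (hLx : 0 ≤ Lx) (hLu : 0 ≤ Lu) (hLxhat : 0 ≤ Lxhat) (hLuhat : 0 ≤ Luhat)
    (hLk : 0 ≤ Lk) (hLkhat : 0 ≤ Lkhat) (hLB : 0 ≤ LB) (hη : 0 ≤ η)
    (hε : 0 < ε) (hE : 0 ≤ E)
    (hB : ∀ x y : Fin n → ℝ, |B x - B y| ≤ LB * ‖x - y‖)
    (hf : ∀ x ∈ X, ∀ x' ∈ X, ∀ u u' : Fin m → ℝ,
      ‖f x u - f x' u'‖ ≤ Lx * ‖x - x'‖ + Lu * ‖u - u'‖)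
    (hfhat : ∀ x ∈ X, ∀ x' ∈ X, ∀ u u' : Fin m → ℝ,
      ‖fhat x u - fhat x' u'‖ ≤ Lxhat * ‖x - x'‖ + Luhat * ‖u - u'‖)
    (hk : ∀ x ∈ X, ∀ x' ∈ X, ‖k x - k x'‖ ≤ Lk * ‖x - x'‖)
    (hkhat : ∀ x ∈ X, ∀ x' ∈ X, ‖khat x - khat x'‖ ≤ Lkhat * ‖x - x'‖)
    (Xd : Finset (Fin n → ℝ)) (hXdX : ↑Xd ⊆ X)
    (hcover : ∀ x ∈ X, ∃ xi ∈ Xd, ‖x - xi‖ ≤ ε / 2)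
    (hmismatch : ∀ xi ∈ Xd, ‖f xi (k xi) - fhat xi (khat xi)‖ ≤ E)
    (hdec : ∀ x ∈ X, B (f x (k x)) - B x ≤ -η) :
    ∀ x ∈ X, B (fhat x (khat x)) - B x ≤
      LB * ((Lx + Lu * Lk + Lxhat + Luhat * Lkhat) * (ε / 2) + E) - η := by
  intro x hx
  obtain ⟨y, hyd, hxy⟩ := hcover x hx
  have hy : y ∈ X := hXdX hyd
  have h1 := hf x hx y hy (k x) (k y)
  have h2 := hfhat x hx y hy (khat x) (khat y)
  have h3 := mul_le_mul_of_nonneg_left (hk x hx y hy) hLu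
  have h4 := mul_le_mul_of_nonneg_left (hkhat x hx y hy) hLuhat
  have h5 := hmismatch y hyd
  have hC : 0 ≤ Lx + Lu * Lk + Lxhat + Luhat * Lkhat := by positivity
  have h6 := mul_le_mul_of_nonneg_left hxy hC
  have h7 : ‖fhat x (khat x) - f x (k x)‖ ≤ ‖fhat x (khat x) - fhat y (khat y)‖
      + ‖f y (k y) - fhat y (khat y)‖ + ‖f x (k x) - f y (k y)‖ := by
    have t1 := norm_sub_le_norm_sub_add_norm_sub (fhat x (khat x)) (fhat y (khat y)) (f x (k x))
    have t2 := norm_sub_le_norm_sub_add_norm_sub (fhat y (khat y)) (f y (k y)) (f x (k x))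
    rw [norm_sub_rev (f y (k y)) (fhat y (khat y)), norm_sub_rev (f x (k x)) (f y (k y))]
    linarith
  have h8 : ‖fhat x (khat x) - f x (k x)‖ ≤
      (Lx + Lu * Lk + Lxhat + Luhat * Lkhat) * (ε / 2) + E := by
    linarith
  have h9 := mul_le_mul_of_nonneg_left h8 hLB
  have h10 := (le_abs_self _).trans (hB (fhat x (khat x)) (f x (k x)))
  have h11 := hdec x hx
  linarith
end

section
/- Let n, m ∈ ℕ and equip ℝⁿ = (Fin n → ℝ) and ℝᵐ = (Fin m → ℝ) with the sup norm. Let X ⊆ ℝⁿ, f, f̂ : ℝⁿ → ℝᵐ → ℝⁿ, k, k̂ : ℝⁿ → ℝᵐ, B : ℝⁿ → ℝ with B 𝓛_B-Lipschitz, and η ≥ 0. Assume the hypotheses: mixed Lipschitz bounds for f with constants 𝓛ₓ, 𝓛ᵤ and for f̂ with constants 𝓛x̂, 𝓛û on X; k 𝓛ₖ-Lipschitz and k̂ 𝓛k̂-Lipschitz on X; a finite (ε/2)-cover X_d ⊆ X of X; sample mismatch bound ‖f xᵢ (k xᵢ) − f̂ xᵢ (k̂ xᵢ)‖ ≤ 𝓔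 for all xᵢ ∈ X_d; the source decrement condition B (f x (k x)) − B x ≤ −η for all x ∈ X; and the validity condition 𝓛_B·((𝓛ₓ + 𝓛ᵤ·𝓛ₖ + 𝓛x̂ + 𝓛û·𝓛k̂)·(ε/2) + 𝓔) ≤ η. Then B is nonincreasing along the target closed loop: B (f̂ x (k̂ x)) − B x ≤ 0 for all x ∈ X. -/
/-- Under the validity condition, the barrier is nonincreasing along the
target closed loop. -/
theorem validity_implies_nonincreasing
    {n m : ℕ}
    (X : Set (Fin n → ℝ))
    (f fhat : (Fin n → ℝ) → (Fin m → ℝ) → (Fin n → ℝ))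
    (k khat : (Fin n → ℝ) → (Fin m → ℝ))
    (B : (Fin n → ℝ) → ℝ)
    (Lx Lu Lxhat Luhat Lk Lkhat LB η ε E : ℝ)
    (hLx : 0 ≤ Lx) (hLu : 0 ≤ Lu) (hLxhat : 0 ≤ Lxhat) (hLuhat : 0 ≤ Luhat)
    (hLk : 0 ≤ Lk) (hLkhat : 0 ≤ Lkhat) (hLB : 0 ≤ LB) (hη : 0 ≤ η)
    (hε : 0 < ε) (hE : 0 ≤ E)
    (hB : ∀ x y : Fin n → ℝ, |B x - B y| ≤ LB * ‖x - y‖)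
    (hf : ∀ x ∈ X, ∀ x' ∈ X, ∀ u u' : Fin m → ℝ,
      ‖f x u - f x' u'‖ ≤ Lx * ‖x - x'‖ + Lu * ‖u - u'‖)
    (hfhat : ∀ x ∈ X, ∀ x' ∈ X, ∀ u u' : Fin m → ℝ,
      ‖fhat x u - fhat x' u'‖ ≤ Lxhat * ‖x - x'‖ + Luhat * ‖u - u'‖)
    (hk : ∀ x ∈ X, ∀ x' ∈ X, ‖k x - k x'‖ ≤ Lk * ‖x - x'‖)
    (hkhat : ∀ x ∈ X, ∀ x' ∈ X, ‖khat x - khat x'‖ ≤ Lkhat * ‖x - x'‖)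
    (Xd : Finset (Fin n → ℝ)) (hXdX : ↑Xd ⊆ X)
    (hcover : ∀ x ∈ X, ∃ xi ∈ Xd, ‖x - xi‖ ≤ ε / 2)
    (hmismatch : ∀ xi ∈ Xd, ‖f xi (k xi) - fhat xi (khat xi)‖ ≤ E)
    (hdec : ∀ x ∈ X, B (f x (k x)) - B x ≤ -η)
    (hvalid : LB * ((Lx + Lu * Lk + Lxhat + Luhat * Lkhat) * (ε / 2) + E) ≤ η) :
    ∀ x ∈ X, B (fhat x (khat x)) - B x ≤ 0 := by
  intro x hx
  obtain ⟨y, hy, hxy⟩ := hcover x hx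
  have hyX : y ∈ X := hXdX hy
  have h1 : ‖f x (k x) - f y (k y)‖ ≤ (Lx + Lu * Lk) * (ε / 2) := by
    calc _ ≤ Lx * ‖x - y‖ + Lu * ‖k x - k y‖ := hf x hx y hyX _ _
      _ ≤ Lx * ‖x - y‖ + Lu * (Lk * ‖x - y‖) := by
        gcongr
        exact hk x hx y hyX
      _ = (Lx + Lu * Lk) * ‖x - y‖ := by ring
      _ ≤ _ := by gcongr
  have h2 : ‖fhat x (khat x) - fhat y (khat y)‖ ≤ (Lxhat + Luhat * Lkhat) * (ε / 2) := by
    calc _ ≤ Lxhat * ‖x - y‖ + Luhat * ‖khat x - khat y‖ := hfhat x hx y hyX _ _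
      _ ≤ Lxhat * ‖x - y‖ + Luhat * (Lkhat * ‖x - y‖) := by
        gcongr
        exact hkhat x hx y hyX
      _ = (Lxhat + Luhat * Lkhat) * ‖x - y‖ := by ring
      _ ≤ _ := by gcongr
  have h3 := hmismatch y hy
  have h4 : ‖fhat x (khat x) - f x (k x)‖ ≤
      (Lx + Lu * Lk + Lxhat + Luhat * Lkhat) * (ε / 2) + E := by
    have e : fhat x (khat x) - f x (k x) = (fhat x (khat x) - fhat y (khat y))
        - (f y (k y) - fhat y (khat y)) - (f x (k x) - f y (k y)) := by abel
    have h5 := norm_sub_le ((fhat x (khat x) - fhat y (khat y))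
        - (f y (k y) - fhat y (khat y))) (f x (k x) - f y (k y))
    have h6 := norm_sub_le (fhat x (khat x) - fhat y (khat y)) (f y (k y) - fhat y (khat y))
    rw [e]
    linarith
  have h7 := (le_abs_self _).trans (hB (fhat x (khat x)) (f x (k x)))
  have h8 := mul_le_mul_of_nonneg_left h4 hLB
  have h9 := hdec x hx
  linarith
end
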